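/- arXiv:2204.11267 — 12 statements merged into one kernel-verified Lean document; each statement's English description precedes it below -/
import Mathlib

section
/- For every positive integer n and every integer j with 1 ≤ j ≤ φ(n), the j-th derivative of the n-th cyclotomic polynomial evaluated at 1 is strictly positive: Φ_n^{(j)}(1) > 0. -/
open Polynomial

namespace Polynomial

/-- If all coefficients of `p` and `q` up to their degrees are positive, the same holds for the
product. -/
theorem coeff_mul_pos_of_coeff_pos {R : Type*} [Semiring R] [PartialOrder R]
    [IsStrictOrderedRing R] {p q : R[X]} (hp : ∀ k ≤ p.natDegree, 0 < p.coeff k)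
    (hq : ∀ k ≤ q.natDegree, 0 < q.coeff k) :
    ∀ k ≤ (p * q).natDegree, 0 < (p * q).coeff k := by
  have nonneg {r : R[X]} (hr : ∀ k ≤ r.natDegree, 0 < r.coeff k) (k : ℕ) : 0 ≤ r.coeff k := by
    rcases le_or_gt k r.natDegree with h | h
    · exact (hr k h).le
    · exact (coeff_eq_zero_of_natDegree_lt h).ge
  intro k hk
  have hk' : k ≤ p.natDegree + q.natDegree := hk.trans natDegree_mul_le
  rw [coeff_mul]
  refine Finset.sum_pos' (fun x _ => mul_nonneg (nonneg hp _) (nonneg hq _))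
    ⟨(min k p.natDegree, k - min k p.natDegree), ?_, mul_pos (hp _ ?_) (hq _ ?_)⟩
  · rw [Finset.HasAntidiagonal.mem_antidiagonal]; dsimp only; omega
  · dsimp only; omega
  · dsimp only; omega

/-- A real monic polynomial whose complex roots all have negative real part has only positive
coefficients up to its degree. -/
theorem Monic.coeff_pos_of_aeval_eq_zero_imp_re_neg {p : ℝ[X]} (hp : p.Monic)
    (h : ∀ z : ℂ, aeval z p = 0 → z.re < 0) : ∀ k ≤ p.natDegree, 0 < p.coeff k := by
  induction hd : p.natDegree using Nat.strong_induction_on generalizing p with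
  | _ d ih =>
  subst hd
  have of_factor {f q : ℝ[X]} (hf : f.Monic) (hfd : 0 < f.natDegree)
      (hfc : ∀ k ≤ f.natDegree, 0 < f.coeff k) (hpq : p = f * q) :
      ∀ k ≤ p.natDegree, 0 < p.coeff k := by
    have hq : q.Monic := hf.of_mul_monic_left (hpq ▸ hp)
    have hdeg : p.natDegree = f.natDegree + q.natDegree := by rw [hpq, hf.natDegree_mul hq]
    have hqc := ih q.natDegree (by omega) hq (fun z hz => h z (by simp [hpq, hz])) rfl
    rw [hpq]
    exact coeff_mul_pos_of_coeff_pos hfc hqc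
  rcases Nat.eq_zero_or_pos p.natDegree with h0 | hpos
  · simp [hp.natDegree_eq_zero.1 h0]
  obtain ⟨z, hz⟩ := IsAlgClosed.exists_aeval_eq_zero ℂ p (natDegree_pos_iff_degree_pos.1 hpos).ne'
  have hre := h z hz
  by_cases him : z.im = 0
  · have hz' : z = algebraMap ℝ ℂ z.re := Complex.ext rfl (by simpa using him)
    rw [hz', aeval_algebraMap_apply, map_eq_zero] at hz
    obtain ⟨q, hq⟩ := dvd_iff_isRoot.2 (show p.IsRoot z.re from by simpa using hz)
    refine of_factor (monic_X_sub_C _) (by simp) (fun k hk => ?_) hq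
    rw [natDegree_X_sub_C] at hk
    interval_cases k <;> simp [hre]
  · obtain ⟨q, hq⟩ := quadratic_dvd_of_aeval_eq_zero_im_ne_zero p hz him
    have hnorm : 0 < ‖z‖ := norm_pos_iff.2 (fun hz0 => him (by simp [hz0]))
    have hquad : X ^ 2 - C (2 * z.re) * X + C (‖z‖ ^ 2) =
        C 1 * X ^ 2 + C (-(2 * z.re)) * X + C (‖z‖ ^ 2) := by
      simp only [map_neg, map_one]; ring
    rw [hquad] at hq
    have hd := natDegree_quadratic (b := -(2 * z.re)) (c := ‖z‖ ^ 2) (one_ne_zero (α := ℝ))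
    refine of_factor (leadingCoeff_quadratic one_ne_zero) (by omega) (fun k hk => ?_) hq
    rw [hd] at hk
    interval_cases k <;> simp [coeff_X, coeff_C, -map_neg, -map_mul, -map_pow] <;>
      nlinarith

end Polynomial

theorem Complex.re_lt_one_of_norm_eq_one {z : ℂ} (hz : ‖z‖ = 1) (h1 : z ≠ 1) : z.re < 1 := by
  refine lt_of_le_of_ne (hz ▸ Complex.re_le_norm z) fun hre => h1 ?_
  have him : z.im = 0 := Complex.abs_re_eq_norm.1 (by rw [hre, hz, abs_one])
  exact Complex.ext hre him

theorem cyclotomic_iterated_deriv_pos_at_one (n j : ℕ) (hn : 0 < n)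
    (hj1 : 1 ≤ j) (hj2 : j ≤ Nat.totient n) :
    0 < (Polynomial.derivative^[j] (Polynomial.cyclotomic n ℝ)).eval 1 := by
  rcases (show n = 1 ∨ 1 < n by omega) with rfl | hn1
  · obtain rfl : j = 1 := by rw [Nat.totient_one] at hj2; omega
    simp
  have hroot (z : ℂ) (hz : aeval z (taylor 1 (cyclotomic n ℝ)) = 0) : z.re < 0 := by
    have hz1 : (cyclotomic n ℂ).IsRoot (z + 1) := by
      rw [taylor_apply, aeval_comp, aeval_def, eval₂_eq_eval_map, map_cyclotomic] at hz
      simpa using hz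
    have : NeZero (n : ℂ) := ⟨by exact_mod_cast hn.ne'⟩
    have hprim := isRoot_cyclotomic_iff.1 hz1
    have := Complex.re_lt_one_of_norm_eq_one (hprim.norm'_eq_one hn.ne') (hprim.ne_one hn1)
    simpa using this
  have hmonic : (taylor 1 (cyclotomic n ℝ)).Monic := (cyclotomic.monic n ℝ).comp_X_add_C 1
  have hcoeff := hmonic.coeff_pos_of_aeval_eq_zero_imp_re_neg hroot j
    (by rwa [natDegree_taylor, natDegree_cyclotomic])
  rw [taylor_coeff] at hcoeff
  rw [← factorial_smul_hasseDeriv, LinearMap.smul_apply, eval_smul, nsmul_eq_mul]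
  positivity
end

section
/- For every positive integer n and every integer k with 0 ≤ k ≤ φ(n) − 1, the function x ↦ Φ_n^{(k)}(x) is strictly increasing on the interval [1, ∞). -/
open Polynomial

/-- Iterated Gauss–Lucas theorem: a convex set containing all roots of a complex polynomial
contains all roots of its iterated derivatives. -/
theorem Polynomial.rootSet_iterate_derivative_subset_of_convex {P : ℂ[X]} {s : Set ℂ}
    (hs : Convex ℝ s) (hP : P.rootSet ℂ ⊆ s) (k : ℕ) :
    (derivative^[k] P).rootSet ℂ ⊆ s := by
  induction k with
  | zero => exact hP
  | succ k ih =>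
    rw [Function.iterate_succ_apply']
    rcases lt_or_ge 0 (derivative^[k] P).degree with hdeg | hdeg
    · exact (rootSet_derivative_subset_convexHull_rootSet hdeg).trans (convexHull_min ih hs)
    · rw [eq_C_of_degree_le_zero hdeg, derivative_C, rootSet_zero]
      exact Set.empty_subset s

theorem Polynomial.leadingCoeff_iterate_derivative_pos {p : ℝ[X]} (hp : 0 < p.leadingCoeff)
    {k : ℕ} (hk : k ≤ p.natDegree) : 0 < (derivative^[k] p).leadingCoeff := by
  have hcoeff : 0 < (derivative^[k] p).coeff (p.natDegree - k) := by
    rw [coeff_iterate_derivative, Nat.sub_add_cancel hk, nsmul_eq_mul]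
    exact mul_pos (by exact_mod_cast Nat.descFactorial_pos.mpr hk) hp
  rwa [leadingCoeff, ((natDegree_iterate_derivative p k).antisymm
    (le_natDegree_of_ne_zero hcoeff.ne'))]

/-- A real polynomial with positive leading coefficient is positive to the right of all its real
roots. -/
theorem Polynomial.eval_pos_of_forall_root_le {p : ℝ[X]} (hp : 0 < p.leadingCoeff) {a : ℝ}
    (hroots : ∀ x, p.IsRoot x → x ≤ a) {x : ℝ} (hx : a < x) : 0 < p.eval x := by
  by_contra! hneg
  rcases lt_or_ge 0 p.degree with hdeg | hdeg
  · obtain ⟨y, hy, hxy⟩ := (((tendsto_atTop_of_leadingCoeff_nonneg p hdeg hp.le).eventually_ge_atTop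
      0).and (Filter.eventually_ge_atTop x)).exists
    obtain ⟨z, hz, hz0⟩ := intermediate_value_Icc hxy p.continuous.continuousOn ⟨hneg, hy⟩
    exact absurd (hroots z hz0) (hx.trans_le hz.1).not_ge
  · rw [eq_C_of_degree_le_zero hdeg, eval_C] at hneg
    rw [eq_C_of_degree_le_zero hdeg, leadingCoeff_C] at hp
    exact hneg.not_gt hp

/-- If all complex roots of a real polynomial with positive leading coefficient lie in the half-plane
`re z ≤ a`, then its derivatives of order less than the degree are strictly increasing
on `[a, ∞)`. -/
theorem Polynomial.strictMonoOn_iterate_derivative {p : ℝ[X]} (hp : 0 < p.leadingCoeff) {a : ℝ}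
    (hroots : p.rootSet ℂ ⊆ {z | z.re ≤ a}) {k : ℕ} (hk : k < p.natDegree) :
    StrictMonoOn (fun x => (derivative^[k] p).eval x) (Set.Ici a) := by
  refine strictMonoOn_of_deriv_pos (convex_Ici a) (derivative^[k] p).continuous.continuousOn ?_
  intro x hx
  rw [interior_Ici, Set.mem_Ioi] at hx
  rw [Polynomial.deriv, ← Function.iterate_succ_apply' derivative]
  have hlead := leadingCoeff_iterate_derivative_pos hp (Nat.succ_le_of_lt hk)
  refine eval_pos_of_forall_root_le hlead (fun y hy => ?_) hx
  have hsub : (derivative^[k.succ] (p.map (algebraMap ℝ ℂ))).rootSet ℂ ⊆ {z | z.re ≤ a} := by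
    refine rootSet_iterate_derivative_subset_of_convex (convex_halfSpace_re_le a) ?_ _
    intro z hz
    refine hroots ?_
    rw [mem_rootSet'] at hz ⊢
    simpa using hz
  have hy' : (y : ℂ) ∈ (derivative^[k.succ] (p.map (algebraMap ℝ ℂ))).rootSet ℂ := by
    rw [iterate_derivative_map, mem_rootSet, coe_aeval_eq_eval]
    refine ⟨Polynomial.map_ne_zero (leadingCoeff_ne_zero.mp hlead.ne'), ?_⟩
    exact hy.map (f := algebraMap ℝ ℂ)
  simpa using hsub hy'

theorem cyclotomic_iterated_deriv_strictMonoOn (n k : ℕ) (hn : 0 < n)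
    (hk : k ≤ Nat.totient n - 1) :
    StrictMonoOn (fun x : ℝ => (Polynomial.derivative^[k] (Polynomial.cyclotomic n ℝ)).eval x)
      (Set.Ici (1 : ℝ)) := by
  refine strictMonoOn_iterate_derivative ?_ (fun z hz => ?_) ?_
  · simp [(cyclotomic.monic n ℝ).leadingCoeff]
  · have hz0 : (cyclotomic n ℂ).IsRoot z := by
      have h := aeval_eq_zero_of_mem_rootSet hz
      rwa [aeval_def, eval₂_eq_eval_map, map_cyclotomic] at h
    have : NeZero (n : ℂ) := ⟨Nat.cast_ne_zero.mpr hn.ne'⟩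
    have hnorm := (isRoot_cyclotomic_iff.mp hz0).norm'_eq_one hn.ne'
    exact (Complex.re_le_norm z).trans hnorm.le
  · rw [natDegree_cyclotomic]
    have := Nat.totient_pos.mpr hn
    lia
end

section
/- For every odd prime p, the derivative of the (2p)-th cyclotomic polynomial is negative at the point 1 − 1/√p: Φ_{2p}'(1 − 1/√p) < 0. -/
open Polynomial

lemma cyclotomic_two_mul_odd_prime_mul_X_add_one {R : Type*} [CommRing R] {p : ℕ}
    (hp : p.Prime) (hodd : Odd p) : cyclotomic (2 * p) R * (X + 1) = X ^ p + 1 := by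
  have hdiv : ¬ p ∣ 2 := fun h ↦ by
    rw [(Nat.prime_dvd_prime_iff_eq hp Nat.prime_two).1 h] at hodd
    exact absurd hodd (by decide)
  simpa [cyclotomic_two] using (cyclotomic_expand_eq_cyclotomic_mul hp hdiv R).symm

lemma lt_exp_sq_sub_one_mul_two_div {s : ℝ} (hs : 1.7 ≤ s) :
    2 * s ^ 2 - s - 1 + 1 / s < Real.exp ((s ^ 2 - 1) * (2 / (2 * s - 1))) := by
  obtain ⟨w, rfl⟩ : ∃ w : ℝ, s = (w + 1) / 2 := ⟨2 * s - 1, by ring⟩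
  have hw : 0 < w := by linarith
  have hs2 : 2 * ((w + 1) / 2) - 1 = w := by ring
  rw [hs2]
  have ht : 0 ≤ (((w + 1) / 2) ^ 2 - 1) * (2 / w) :=
    mul_nonneg (by nlinarith) (by positivity)
  refine lt_of_lt_of_le ?_ (Real.sum_le_exp_of_nonneg ht 5)
  simp only [Finset.sum_range_succ, Finset.sum_range_zero, Nat.factorial]
  rw [← sub_pos]
  push_cast
  field_simp
  obtain ⟨a, ha, rfl⟩ : ∃ a : ℝ, 0 ≤ a ∧ w = 2.4 + a := ⟨w - 2.4, by linarith, by ring⟩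
  ring_nf
  positivity

lemma one_sub_inv_pow_mul_lt_one {n : ℕ} {s : ℝ} (hs : 1.7 ≤ s) (hn : (n : ℝ) = s ^ 2 - 1) :
    (1 - 1 / s) ^ n * (2 * s ^ 2 - s - 1 + 1 / s) < 1 := by
  have hs1 : 0 < s - 1 := by linarith
  have hs0 : 0 < s := by linarith
  have hinv : 1 - 1 / s = (1 + 1 / (s - 1))⁻¹ := by field_simp; ring
  have hpos : 0 < 1 + 1 / (s - 1) := by positivity
  have hlog : 2 / (2 * s - 1) ≤ Real.log (1 + 1 / (s - 1)) := by
    convert Real.le_log_one_add_of_nonneg (x := 1 / (s - 1)) (by positivity) using 1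
    have : 0 < 2 * s - 1 := by linarith
    have : 0 < 1 + (s - 1) * 2 := by linarith
    field_simp
    ring
  have hexp : Real.exp ((s ^ 2 - 1) * (2 / (2 * s - 1))) ≤ (1 + 1 / (s - 1)) ^ n := by
    rw [← Real.exp_log (pow_pos hpos n), Real.log_pow, hn]
    exact Real.exp_le_exp.2 (mul_le_mul_of_nonneg_left hlog (by nlinarith))
  rw [hinv, inv_pow, inv_mul_lt_iff₀ (pow_pos hpos n), mul_one]
  exact (lt_exp_sq_sub_one_mul_two_div hs).trans_le hexp

theorem cyclotomic_two_mul_prime_deriv_neg (p : ℕ) (hp : p.Prime) (hodd : Odd p) :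
    (Polynomial.derivative (Polynomial.cyclotomic (2 * p) ℝ)).eval
      (1 - 1 / Real.sqrt p) < 0 := by
  have h3 : 3 ≤ p := by
    have := hp.two_le
    obtain ⟨k, rfl⟩ := hodd
    omega
  obtain ⟨n, rfl⟩ : ∃ n, p = n + 1 := ⟨p - 1, by omega⟩
  set s := Real.sqrt ((n + 1 : ℕ) : ℝ) with hsdef
  have hsq : s ^ 2 = n + 1 := by rw [hsdef, Real.sq_sqrt (by positivity)]; push_cast; ring
  have hs : 1.7 ≤ s := by
    apply Real.le_sqrt_of_sq_le
    have : (3 : ℝ) ≤ ((n + 1 : ℕ) : ℝ) := by exact_mod_cast h3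
    norm_num at this ⊢
    linarith
  have hs0 : 0 < s := by linarith
  have hbound := one_sub_inv_pow_mul_lt_one (n := n) hs (by linarith)
  have hfac := cyclotomic_two_mul_odd_prime_mul_X_add_one (R := ℝ) hp hodd
  have hval := congrArg (eval (1 - 1 / s)) hfac
  have hder := congrArg (fun q ↦ eval (1 - 1 / s) (derivative q)) hfac
  have hx : 0 < 1 - 1 / s + 1 := by
    have : 1 / s ≤ 1 := by rw [div_le_one hs0]; linarith
    linarith
  simp only [eval_mul, eval_add, eval_X, eval_one, eval_pow] at hval
  simp only [derivative_mul, derivative_add, derivative_X, derivative_one, derivative_X_pow,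
    eval_mul, eval_add, eval_X, eval_one, eval_pow, add_zero, mul_one, eval_C,
    Nat.add_sub_cancel, Nat.cast_add, Nat.cast_one, ← hsq] at hder
  have hcoef : s ^ 2 * (1 - 1 / s + 1) - (1 - 1 / s) = 2 * s ^ 2 - s - 1 + 1 / s := by
    field_simp
    ring
  rw [← hcoef] at hbound
  set x := 1 - 1 / s
  rw [pow_succ] at hval
  have key : eval x (derivative (cyclotomic (2 * (n + 1)) ℝ)) * (x + 1) ^ 2 < 0 := by
    linear_combination hbound + (x + 1) * hder - hval
  exact neg_of_mul_neg_left key (by positivity)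
end

section
/- For every integer n ≥ 2, we have 2·Φ_n'(1) = φ(n)·Φ_n(1), where both sides are integers. -/
open Polynomial

/-- The logarithmic derivative of a complex cyclotomic polynomial at `1`. -/
theorem eval_one_derivative_cyclotomic_complex {n : ℕ} (hn : 2 ≤ n) :
    (derivative (cyclotomic n ℂ)).eval 1 =
      (cyclotomic n ℂ).eval 1 * ∑ ζ ∈ primitiveRoots n ℂ, (1 - ζ)⁻¹ := by
  have hne : ∀ ζ ∈ primitiveRoots n ℂ, (1 : ℂ) - ζ ≠ 0 := fun ζ hζ =>
    sub_ne_zero.mpr ((isPrimitiveRoot_of_mem_primitiveRoots hζ).ne_one hn).symm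
  rw [cyclotomic_eq_prod_X_sub_primitiveRoots (Complex.isPrimitiveRoot_exp n (by lia)),
    derivative_prod_finset, eval_finsetSum, eval_prod, Finset.mul_sum]
  refine Finset.sum_congr rfl fun ζ hζ => ?_
  rw [← Finset.mul_prod_erase _ _ hζ]
  simp only [derivative_X_sub_C, mul_one, eval_prod, eval_sub, eval_X, eval_C]
  field_simp [hne ζ hζ]

/-- Inversion of primitive roots pairs the terms `(1 - ζ)⁻¹` into pairs of sum `1`. -/
theorem two_mul_sum_primitiveRoots_inv_one_sub {n : ℕ} (hn : 2 ≤ n) :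
    2 * ∑ ζ ∈ primitiveRoots n ℂ, (1 - ζ)⁻¹ = n.totient := by
  have hpos : 0 < n := by lia
  have hinv : ∑ ζ ∈ primitiveRoots n ℂ, (1 - ζ)⁻¹ =
      ∑ ζ ∈ primitiveRoots n ℂ, (1 - ζ⁻¹)⁻¹ := by
    refine Finset.sum_nbij' (·⁻¹) (·⁻¹) ?_ ?_ ?_ ?_ ?_ <;>
      simp [mem_primitiveRoots hpos]
  rw [two_mul]
  nth_rewrite 2 [hinv]
  rw [← Finset.sum_add_distrib, ← Complex.card_primitiveRoots n, Finset.cast_card]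
  refine Finset.sum_congr rfl fun ζ hζ => ?_
  have h := isPrimitiveRoot_of_mem_primitiveRoots hζ
  have h0 : ζ ≠ 0 := h.ne_zero hpos.ne'
  have h2 : ζ - 1 ≠ 0 := sub_ne_zero.mpr (h.ne_one hn)
  have h3 : 1 - ζ⁻¹ = (ζ - 1) / ζ := by field_simp
  rw [h3, inv_div, ← neg_sub ζ 1]
  field_simp
  ring

theorem two_mul_cyclotomic_deriv_one (n : ℕ) (hn : 2 ≤ n) :
    2 * (Polynomial.derivative (Polynomial.cyclotomic n ℤ)).eval 1 =
      (Nat.totient n : ℤ) * (Polynomial.cyclotomic n ℤ).eval 1 := by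
  have hcast (p : ℤ[X]) : ((p.eval 1 : ℤ) : ℂ) = (p.map (Int.castRingHom ℂ)).eval 1 := by
    simp [eval_one_map]
  apply Int.cast_injective (α := ℂ)
  push_cast
  rw [hcast, hcast, ← derivative_map, map_cyclotomic_int,
    eval_one_derivative_cyclotomic_complex hn, ← two_mul_sum_primitiveRoots_inv_one_sub hn]
  ring
end

section
/- For every integer n ≥ 2 and every integer ℓ with 0 ≤ ℓ < φ(n), the integer Φ_n(1) divides Φ_n^{(ℓ)}(1); in particular Φ_n^{(ℓ)}(1)/Φ_n(1) is a positive integer. -/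
open Polynomial

/-- A real polynomial with nonnegative leading coefficient is positive at every point which lies
strictly to the right of all its complex roots. -/
theorem Polynomial.eval_pos_of_forall_root_re_lt {P : ℝ[X]} {c : ℝ} (hP : 0 ≤ P.leadingCoeff)
    (hroots : ∀ z : ℂ, aeval z P = 0 → z.re < c) : 0 < P.eval c := by
  refine zero_lt_eval_of_roots_lt_of_leadingCoeff_nonneg (fun y hy => ?_) hP
  rw [← Complex.ofReal_re y]
  refine hroots y ?_
  rw [← Complex.coe_algebraMap, aeval_algebraMap_apply, coe_aeval_eq_eval, hy.eq_zero, map_zero]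

/-- If all complex roots of a nonconstant real polynomial lie in an open left half-plane, then so
do those of its derivative. -/
theorem Polynomial.re_lt_of_aeval_derivative_eq_zero {P : ℝ[X]} {c : ℝ} (hP : 0 < P.natDegree)
    (hroots : ∀ z : ℂ, aeval z P = 0 → z.re < c) {z : ℂ} (hz : aeval z (derivative P) = 0) :
    z.re < c := by
  set Q : ℂ[X] := P.map (algebraMap ℝ ℂ) with hQ
  have hQdeg : 0 < Q.degree := by
    rwa [degree_map, ← natDegree_pos_iff_degree_pos]
  have hzQ : (derivative Q).eval z = 0 := by
    rw [hQ, derivative_map, eval_map_algebraMap, hz]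
  have hmem : z ∈ convexHull ℝ (Q.rootSet ℂ) := by
    refine rootSet_derivative_subset_convexHull_rootSet hQdeg ?_
    rw [mem_rootSet, coe_aeval_eq_eval]
    exact ⟨derivative_ne_zero.mpr (natDegree_pos_iff_degree_pos.mpr hQdeg).ne', hzQ⟩
  refine convexHull_min (t := {w : ℂ | w.re < c}) (fun w hw => ?_)
    (convex_halfSpace_re_lt c) hmem
  refine hroots w ?_
  rw [mem_rootSet, coe_aeval_eq_eval, hQ, eval_map_algebraMap] at hw
  exact hw.2

/-- If all complex roots of a real polynomial with nonnegative leading coefficient have real part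
less than `c`, then its derivatives of order at most its degree are positive at `c`. -/
theorem Polynomial.eval_iterate_derivative_pos_of_forall_root_re_lt {c : ℝ} {k : ℕ} {P : ℝ[X]}
    (hP : 0 ≤ P.leadingCoeff) (hk : k ≤ P.natDegree)
    (hroots : ∀ z : ℂ, aeval z P = 0 → z.re < c) : 0 < (derivative^[k] P).eval c := by
  induction k generalizing P with
  | zero => exact eval_pos_of_forall_root_re_lt hP hroots
  | succ k ih =>
    have hdeg : 0 < P.natDegree := by lia
    have hnat : (derivative P).natDegree = P.natDegree - 1 := natDegree_derivative P
    refine ih (P := derivative P) ?_ (by lia)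
      fun z hz => re_lt_of_aeval_derivative_eq_zero hdeg hroots hz
    rw [leadingCoeff_derivative]
    positivity

theorem IsPrimitiveRoot.re_lt_one {n : ℕ} (hn : 2 ≤ n) {z : ℂ} (hz : IsPrimitiveRoot z n) :
    z.re < 1 := by
  have hnorm : ‖z‖ = 1 := hz.norm'_eq_one (by lia)
  refine lt_of_le_of_ne (hnorm ▸ Complex.re_le_norm z) fun hre => ?_
  refine hz.ne_one (by lia) ?_
  have him : z.im = 0 := Complex.abs_re_eq_norm.mp (by rw [hre, hnorm, abs_one])
  exact Complex.ext hre him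

/-- All derivatives of order at most `φ n` of the `n`-th cyclotomic polynomial are positive
at `1`. -/
theorem Polynomial.eval_one_iterate_derivative_cyclotomic_pos {n ℓ : ℕ} (hn : 2 ≤ n)
    (hℓ : ℓ ≤ n.totient) : 0 < (derivative^[ℓ] (cyclotomic n ℤ)).eval 1 := by
  have : NeZero n := ⟨by lia⟩
  have hpos : 0 < (derivative^[ℓ] (cyclotomic n ℝ)).eval 1 := by
    refine eval_iterate_derivative_pos_of_forall_root_re_lt ?_ ?_ fun z hz => ?_
    · rw [cyclotomic.monic n ℝ]
      exact zero_le_one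
    · rwa [natDegree_cyclotomic]
    · rw [← eval_map_algebraMap, map_cyclotomic] at hz
      exact (isRoot_cyclotomic_iff.mp hz).re_lt_one hn
  rw [← map_cyclotomic_int, iterate_derivative_map, eval_one_map, eq_intCast] at hpos
  exact_mod_cast hpos

/-- The derivatives of order less than `φ (p ^ k)` of the `p ^ k`-th cyclotomic polynomial are
divisible by `p` at `1`. -/
theorem Polynomial.prime_dvd_eval_one_iterate_derivative_cyclotomic {p k ℓ : ℕ} [Fact p.Prime]
    (hk : 0 < k) (hℓ : ℓ < (p ^ k).totient) :
    (p : ℤ) ∣ (derivative^[ℓ] (cyclotomic (p ^ k) ℤ)).eval 1 := by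
  have hp : p.Prime := Fact.out
  have hcyc : cyclotomic (p ^ k) (ZMod p) = (X - C 1) ^ (p ^ k).totient := by
    have h := cyclotomic_mul_prime_pow_eq (ZMod p) (p := p) (m := 1) hp.not_dvd_one hk
    rw [mul_one, cyclotomic_one] at h
    rw [h, C_1]
    congr 1
    rw [Nat.totient_prime_pow hp hk, Nat.mul_sub, mul_one, ← pow_succ, Nat.sub_add_cancel hk]
  rw [← ZMod.intCast_zmod_eq_zero_iff_dvd, ← eq_intCast (Int.castRingHom (ZMod p)), ← eval_one_map,
    ← iterate_derivative_map, map_cyclotomic_int, hcyc, iterate_derivative_X_sub_pow]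
  simp [Nat.sub_ne_zero_of_lt hℓ]

theorem cyclotomic_eval_one_dvd_iterated_deriv (n ℓ : ℕ) (hn : 2 ≤ n)
    (hℓ : ℓ < Nat.totient n) :
    ∃ m : ℤ, 0 < m ∧
      (Polynomial.derivative^[ℓ] (Polynomial.cyclotomic n ℤ)).eval 1 =
        (Polynomial.cyclotomic n ℤ).eval 1 * m := by
  have hpos := eval_one_iterate_derivative_cyclotomic_pos hn hℓ.le
  have hdvd : (cyclotomic n ℤ).eval 1 ∣ (derivative^[ℓ] (cyclotomic n ℤ)).eval 1 := by
    by_cases h : ∃ p : ℕ, p.Prime ∧ ∃ k : ℕ, p ^ k = n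
    · obtain ⟨p, hp, k, rfl⟩ := h
      have : Fact p.Prime := ⟨hp⟩
      obtain ⟨k, rfl⟩ : ∃ j, k = j + 1 :=
        Nat.exists_eq_succ_of_ne_zero (by rintro rfl; simp at hn)
      rw [eval_one_cyclotomic_prime_pow]
      exact prime_dvd_eval_one_iterate_derivative_cyclotomic k.succ_pos hℓ
    · push Not at h
      rw [eval_one_cyclotomic_not_prime_pow fun hp k => h _ hp k]
      exact one_dvd _
  obtain ⟨m, hm⟩ := hdvd
  refine ⟨m, ?_, hm⟩
  rw [hm] at hpos
  exact pos_of_mul_pos_right hpos (cyclotomic_nonneg n le_rfl)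
end

section
/- For every integer n ≥ 2, one has the integer identity 12·Φ_n''(1) = Φ_n(1)·( J_2(n) + 3·φ(n)² − 6·φ(n) ). -/
open Polynomial Finset

/-- Jordan totient function `J_k(n) = Σ_{d ∣ n} μ(n/d)·d^k`. -/
def jordanTotient (k n : ℕ) : ℤ :=
  ∑ d ∈ n.divisors, (ArithmeticFunction.moebius (n / d) : ℤ) * (d : ℤ) ^ k

theorem sum_divisors_jordanTotient (k : ℕ) {n : ℕ} (hn : 0 < n) :
    ∑ d ∈ n.divisors, jordanTotient k d = (n : ℤ) ^ k := by
  refine (ArithmeticFunction.sum_eq_iff_sum_mul_moebius_eq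
    (f := jordanTotient k) (g := fun m : ℕ => (m : ℤ) ^ k)).2 (fun m _ => ?_) n hn
  simpa [jordanTotient] using Nat.sum_divisorsAntidiagonal' (n := m)
    (f := fun a b => ArithmeticFunction.moebius a * (b : ℤ) ^ k)

/-- A function on integers `≥ 2` is determined by its sums over the nontrivial divisors. -/
theorem eq_of_sum_divisors_erase_one_eq {M : Type*} [AddCommGroup M] {f g : ℕ → M}
    (h : ∀ n, 0 < n → ∑ d ∈ n.divisors.erase 1, f d = ∑ d ∈ n.divisors.erase 1, g d)
    {n : ℕ} (hn : 2 ≤ n) : f n = g n := by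
  induction n using Nat.strong_induction_on with
  | _ n ih =>
    have hmem : n ∈ n.divisors.erase 1 := by simp; omega
    have hsum := h n (by omega)
    rw [← Finset.add_sum_erase _ _ hmem, ← Finset.add_sum_erase _ _ hmem] at hsum
    have hproper : ∑ d ∈ (n.divisors.erase 1).erase n, f d =
        ∑ d ∈ (n.divisors.erase 1).erase n, g d := by
      refine Finset.sum_congr rfl fun d hd => ?_
      simp only [Finset.mem_erase, Nat.mem_divisors] at hd
      have hle := Nat.le_of_dvd (by omega) hd.2.2.1
      have hpos := Nat.pos_of_dvd_of_pos hd.2.2.1 (by omega)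
      exact ih d (by omega) (by omega)
    rw [hproper] at hsum
    exact add_right_cancel hsum

namespace Polynomial

variable {K : Type*} [Field K]

/-- The value at `a` of the logarithmic derivative of `p`. -/
noncomputable def logDerivAt (a : K) (p : K[X]) : K :=
  (derivative p).eval a / p.eval a

/-- The value at `a` of the derivative of the logarithmic derivative of `p`. -/
noncomputable def logDerivTwoAt (a : K) (p : K[X]) : K :=
  (derivative (derivative p)).eval a / p.eval a - logDerivAt a p ^ 2

theorem logDerivAt_mul {a : K} {p q : K[X]} (hp : p.eval a ≠ 0) (hq : q.eval a ≠ 0) :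
    logDerivAt a (p * q) = logDerivAt a p + logDerivAt a q := by
  simp only [logDerivAt, derivative_mul, eval_add, eval_mul]
  field_simp

theorem logDerivTwoAt_mul {a : K} {p q : K[X]} (hp : p.eval a ≠ 0) (hq : q.eval a ≠ 0) :
    logDerivTwoAt a (p * q) = logDerivTwoAt a p + logDerivTwoAt a q := by
  simp only [logDerivTwoAt, logDerivAt, derivative_mul, derivative_add, eval_add, eval_mul]
  field_simp
  ring

theorem logDerivAt_prod {ι : Type*} {a : K} (s : Finset ι) {p : ι → K[X]}
    (h : ∀ i ∈ s, (p i).eval a ≠ 0) :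
    logDerivAt a (∏ i ∈ s, p i) = ∑ i ∈ s, logDerivAt a (p i) := by
  classical
  induction s using Finset.induction_on with
  | empty => simp [logDerivAt]
  | insert i s hi ih =>
    rw [Finset.forall_mem_insert] at h
    rw [Finset.prod_insert hi, Finset.sum_insert hi, logDerivAt_mul h.1, ih h.2]
    rw [eval_prod]
    exact Finset.prod_ne_zero_iff.2 h.2

theorem logDerivTwoAt_prod {ι : Type*} {a : K} (s : Finset ι) {p : ι → K[X]}
    (h : ∀ i ∈ s, (p i).eval a ≠ 0) :
    logDerivTwoAt a (∏ i ∈ s, p i) = ∑ i ∈ s, logDerivTwoAt a (p i) := by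
  classical
  induction s using Finset.induction_on with
  | empty => simp [logDerivTwoAt, logDerivAt]
  | insert i s hi ih =>
    rw [Finset.forall_mem_insert] at h
    rw [Finset.prod_insert hi, Finset.sum_insert hi, logDerivTwoAt_mul h.1, ih h.2]
    rw [eval_prod]
    exact Finset.prod_ne_zero_iff.2 h.2

theorem eval_one_derivative_geom_sum (n : ℕ) :
    (derivative (∑ i ∈ range n, (X : ℚ[X]) ^ i)).eval 1 = n * (n - 1) / 2 := by
  induction n with
  | zero => simp
  | succ n ih =>
    rw [Finset.sum_range_succ, derivative_add, eval_add, ih]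
    simp [derivative_X_pow]
    ring

theorem eval_one_derivative_derivative_geom_sum (n : ℕ) :
    (derivative (derivative (∑ i ∈ range n, (X : ℚ[X]) ^ i))).eval 1 =
      n * (n - 1) * (n - 2) / 3 := by
  induction n with
  | zero => simp
  | succ n ih =>
    rw [Finset.sum_range_succ, derivative_add, derivative_add, eval_add, ih]
    rcases n with _ | n
    · simp
    · simp [derivative_X_pow]
      ring

theorem logDerivAt_one_geom_sum {n : ℕ} (hn : 0 < n) :
    logDerivAt 1 (∑ i ∈ range n, (X : ℚ[X]) ^ i) = (n - 1) / 2 := by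
  have hn' : (n : ℚ) ≠ 0 := by positivity
  rw [logDerivAt, eval_one_derivative_geom_sum]
  simp only [eval_geom_sum, one_pow, sum_const, card_range, nsmul_eq_mul, mul_one]
  field_simp

theorem logDerivTwoAt_one_geom_sum {n : ℕ} (hn : 0 < n) :
    logDerivTwoAt 1 (∑ i ∈ range n, (X : ℚ[X]) ^ i) = (n - 1) * (n - 5) / 12 := by
  have hn' : (n : ℚ) ≠ 0 := by positivity
  rw [logDerivTwoAt, logDerivAt_one_geom_sum hn, eval_one_derivative_derivative_geom_sum]
  simp only [eval_geom_sum, one_pow, sum_const, card_range, nsmul_eq_mul, mul_one]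
  field_simp
  ring

theorem eval_one_cyclotomic_ne_zero {n : ℕ} (hn : n ≠ 1) :
    (cyclotomic n ℚ).eval 1 ≠ 0 := by
  intro h
  rcases Nat.eq_zero_or_pos n with rfl | hpos
  · simp at h
  · have : NeZero (n : ℚ) := ⟨by positivity⟩
    exact hn ((isRoot_cyclotomic_iff.1 h).unique IsPrimitiveRoot.one)

theorem logDerivAt_one_cyclotomic {n : ℕ} (hn : 2 ≤ n) :
    logDerivAt 1 (cyclotomic n ℚ) = (n.totient : ℚ) / 2 := by
  refine eq_of_sum_divisors_erase_one_eq (f := fun n => logDerivAt 1 (cyclotomic n ℚ))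
    (g := fun n => (n.totient : ℚ) / 2) (fun m hm => ?_) hn
  rw [← logDerivAt_prod _ fun d hd => eval_one_cyclotomic_ne_zero (Finset.ne_of_mem_erase hd),
    prod_cyclotomic_eq_geom_sum hm, logDerivAt_one_geom_sum hm, ← Finset.sum_div]
  have h := (Finset.add_sum_erase m.divisors (fun d => (d.totient : ℚ))
    (Nat.one_mem_divisors.2 hm.ne')).symm
  rw [← Nat.cast_sum, Nat.sum_totient] at h
  rw [h]
  simp

theorem logDerivTwoAt_one_cyclotomic {n : ℕ} (hn : 2 ≤ n) :
    logDerivTwoAt 1 (cyclotomic n ℚ) = ((jordanTotient 2 n : ℚ) - 6 * n.totient) / 12 := by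
  refine eq_of_sum_divisors_erase_one_eq (f := fun n => logDerivTwoAt 1 (cyclotomic n ℚ))
    (g := fun n => ((jordanTotient 2 n : ℚ) - 6 * n.totient) / 12) (fun m hm => ?_) hn
  rw [← logDerivTwoAt_prod _ fun d hd => eval_one_cyclotomic_ne_zero (Finset.ne_of_mem_erase hd),
    prod_cyclotomic_eq_geom_sum hm, logDerivTwoAt_one_geom_sum hm, ← Finset.sum_div]
  have h := (Finset.add_sum_erase m.divisors
    (fun d => (jordanTotient 2 d : ℚ) - 6 * d.totient) (Nat.one_mem_divisors.2 hm.ne')).symm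
  rw [Finset.sum_sub_distrib, ← Finset.mul_sum, ← Nat.cast_sum, Nat.sum_totient,
    ← Int.cast_sum, sum_divisors_jordanTotient 2 hm] at h
  simp only [jordanTotient, Nat.divisors_one, sum_singleton, Nat.div_self one_pos,
    ArithmeticFunction.moebius_apply_one, Nat.totient_one] at h ⊢
  push_cast at h ⊢
  linear_combination (1 / 12 : ℚ) * h

end Polynomial

theorem cyclotomic_second_deriv_one (n : ℕ) (hn : 2 ≤ n) :
    12 * (Polynomial.derivative^[2] (Polynomial.cyclotomic n ℤ)).eval 1 =
      (Polynomial.cyclotomic n ℤ).eval 1 *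
        (jordanTotient 2 n + 3 * (Nat.totient n : ℤ) ^ 2 - 6 * (Nat.totient n : ℤ)) := by
  have h0 := eval_one_cyclotomic_ne_zero (n := n) (by omega)
  have h := logDerivTwoAt_one_cyclotomic hn
  rw [logDerivTwoAt, logDerivAt_one_cyclotomic hn] at h
  have hcast (p : ℤ[X]) : ((p.eval 1 : ℤ) : ℚ) = (p.map (Int.castRingHom ℚ)).eval 1 := by
    rw [eval_one_map]
    simp
  have key : ((12 * (Polynomial.derivative^[2] (cyclotomic n ℤ)).eval 1 : ℤ) : ℚ) =
      (((cyclotomic n ℤ).eval 1 *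
        (jordanTotient 2 n + 3 * (n.totient : ℤ) ^ 2 - 6 * (n.totient : ℤ)) : ℤ) : ℚ) := by
    push_cast
    simp only [hcast, Function.iterate_succ, Function.iterate_zero, Function.comp_apply, id_eq,
      ← derivative_map, map_cyclotomic]
    field_simp at h
    linear_combination (1 / 4 : ℚ) * h
  exact_mod_cast key
end

section
/- For every integer n ≥ 2, one has the integer identity 8·Φ_n'''(1) = Φ_n(1)·(φ(n) − 2)·( J_2(n) + φ(n)·(φ(n) − 4) ). -/
open Polynomial Finset

/-- The first three derivatives of `p` at `1`, relative to `p(1)`, are those prescribed by the pair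
`(a, b)`; in terms of `log p(exp t)`, the cumulants at `t = 0` are `a / 2`, `b / 12` and `0`. -/
def HasJetAtOne (p : ℤ[X]) (a b : ℤ) : Prop :=
  2 * (derivative p).eval 1 = p.eval 1 * a ∧
  12 * (derivative (derivative p)).eval 1 = p.eval 1 * (b - 6 * a + 3 * a ^ 2) ∧
  8 * (derivative (derivative (derivative p))).eval 1 = p.eval 1 * ((a - 2) * (b + a * (a - 4)))

namespace HasJetAtOne

theorem one : HasJetAtOne 1 0 0 := by
  simp [HasJetAtOne]

theorem mul {p q : ℤ[X]} {a b c d : ℤ} (hp : HasJetAtOne p a b) (hq : HasJetAtOne q c d) :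
    HasJetAtOne (p * q) (a + c) (b + d) := by
  obtain ⟨p1, p2, p3⟩ := hp
  obtain ⟨q1, q2, q3⟩ := hq
  simp only [HasJetAtOne, derivative_mul, derivative_add, eval_add, eval_mul]
  generalize eval 1 (derivative (derivative (derivative p))) = P3 at *
  generalize eval 1 (derivative (derivative p)) = P2 at *
  generalize eval 1 (derivative p) = P1 at *
  generalize eval 1 p = P at *
  generalize eval 1 (derivative (derivative (derivative q))) = Q3 at *
  generalize eval 1 (derivative (derivative q)) = Q2 at *
  generalize eval 1 (derivative q) = Q1 at *
  generalize eval 1 q = Q at *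
  refine ⟨?_, ?_, ?_⟩
  · linear_combination Q * p1 + P * q1
  · linear_combination Q * p2 + P * q2 + 12 * Q1 * p1 + 6 * P * a * q1
  · linear_combination Q * p3 + P * q3 + 2 * Q1 * p2 + P * (b - 6 * a + 3 * a ^ 2) * q1 +
      2 * P1 * q2 + Q * (d - 6 * c + 3 * c ^ 2) * p1

theorem prod {ι : Type*} (s : Finset ι) (p : ι → ℤ[X]) (a b : ι → ℤ)
    (h : ∀ i ∈ s, HasJetAtOne (p i) (a i) (b i)) :
    HasJetAtOne (∏ i ∈ s, p i) (∑ i ∈ s, a i) (∑ i ∈ s, b i) := by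
  classical
  induction s using Finset.induction_on with
  | empty => simpa using one
  | insert i s hi ih =>
    rw [Finset.prod_insert hi, Finset.sum_insert hi, Finset.sum_insert hi]
    exact (h i (Finset.mem_insert_self i s)).mul
      (ih fun j hj => h j (Finset.mem_insert_of_mem hj))

theorem of_mul_left {p q : ℤ[X]} {a b c d : ℤ} (hp0 : p.eval 1 ≠ 0) (hp : HasJetAtOne p a b)
    (hpq : HasJetAtOne (p * q) (a + c) (b + d)) : HasJetAtOne q c d := by
  obtain ⟨p1, p2, p3⟩ := hp
  simp only [HasJetAtOne, derivative_mul, derivative_add, eval_add, eval_mul] at hpq ⊢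
  generalize eval 1 (derivative (derivative (derivative p))) = P3 at *
  generalize eval 1 (derivative (derivative p)) = P2 at *
  generalize eval 1 (derivative p) = P1 at *
  generalize eval 1 p = P at *
  generalize eval 1 (derivative (derivative (derivative q))) = Q3 at *
  generalize eval 1 (derivative (derivative q)) = Q2 at *
  generalize eval 1 (derivative q) = Q1 at *
  generalize eval 1 q = Q at *
  obtain ⟨r1, r2, r3⟩ := hpq
  have q1 : 2 * Q1 = Q * c := by
    apply mul_left_cancel₀ hp0
    linear_combination r1 - Q * p1
  have q2 : 12 * Q2 = Q * (d - 6 * c + 3 * c ^ 2) := by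
    apply mul_left_cancel₀ hp0
    linear_combination r2 - (Q * p2 + 12 * Q1 * p1 + 6 * P * a * q1)
  refine ⟨q1, q2, ?_⟩
  apply mul_left_cancel₀ hp0
  linear_combination r3 - (Q * p3 + 2 * Q1 * p2 + P * (b - 6 * a + 3 * a ^ 2) * q1 +
      2 * P1 * q2 + Q * (d - 6 * c + 3 * c ^ 2) * p1)

theorem geom_sum (n : ℕ) :
    HasJetAtOne (∑ i ∈ Finset.range n, X ^ i) ((n : ℤ) - 1) ((n : ℤ) ^ 2 - 1) := by
  have hderiv (k : ℕ) : derivative^[k] ((X - 1 : ℤ[X]) * ∑ i ∈ Finset.range n, X ^ i) =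
      derivative^[k] (X ^ n - 1) := by
    rw [mul_geom_sum]
  have h0 : eval 1 (∑ i ∈ Finset.range n, (X : ℤ[X]) ^ i) = n := by
    simp [eval_finsetSum]
  have h2 := congrArg (eval 1) (hderiv 2)
  have h3 := congrArg (eval 1) (hderiv 3)
  have h4 := congrArg (eval 1) (hderiv 4)
  have hX (k : ℕ) : eval 1 (derivative^[k + 1] (X ^ n - 1 : ℤ[X])) =
      (descPochhammer ℤ (k + 1)).eval (n : ℤ) := by
    rw [iterate_derivative_sub, iterate_derivative_one (by omega),
      iterate_derivative_X_pow_eq_natCast_mul]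
    simp [descPochhammer_eval_eq_descFactorial]
  rw [hX] at h2 h3 h4
  unfold HasJetAtOne
  rw [h0]
  generalize ∑ i ∈ Finset.range n, (X : ℤ[X]) ^ i = p at *
  simp [derivative_mul, descPochhammer_succ_right] at h2 h3 h4
  refine ⟨?_, ?_, ?_⟩
  · linear_combination h2
  · linear_combination 4 * h3
  · linear_combination 2 * h4

end HasJetAtOne

theorem hasJetAtOne_cyclotomic {n : ℕ} (hn : 2 ≤ n) :
    HasJetAtOne (cyclotomic n ℤ) n.totient (jordanTotient 2 n) := by
  induction n using Nat.strong_induction_on with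
  | _ n ih =>
  have hmem : n ∈ n.divisors.erase 1 := by
    simp; omega
  have h1 : 1 ∈ n.divisors := by simp; omega
  set s := (n.divisors.erase 1).erase n with hs
  have hprod : (∏ d ∈ s, cyclotomic d ℤ) * cyclotomic n ℤ = ∑ i ∈ Finset.range n, X ^ i := by
    rw [Finset.prod_erase_mul _ _ hmem, prod_cyclotomic_eq_geom_sum (by omega)]
  have hsplit (f : ℕ → ℤ) : (∑ d ∈ s, f d) + f n = (∑ d ∈ n.divisors, f d) - f 1 := by
    rw [Finset.sum_erase_add _ _ hmem, ← Finset.sum_erase_add _ _ h1, add_sub_cancel_right]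
  have hφ := hsplit fun d => d.totient
  have hJ := hsplit (jordanTotient 2)
  rw [sum_divisors_jordanTotient 2 (by omega)] at hJ
  rw [← Nat.cast_sum n.divisors, Nat.sum_totient] at hφ
  have hjet : HasJetAtOne (∏ d ∈ s, cyclotomic d ℤ) (∑ d ∈ s, (d.totient : ℤ))
      (∑ d ∈ s, jordanTotient 2 d) := by
    refine HasJetAtOne.prod _ _ _ _ fun d hd => ?_
    simp only [hs, Finset.mem_erase, Nat.mem_divisors] at hd
    have hle := Nat.le_of_dvd (by omega) hd.2.2.1
    have hpos := Nat.pos_of_dvd_of_pos hd.2.2.1 (by omega)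
    exact ih d (by omega) (by omega)
  refine hjet.of_mul_left (fun h => ?_) ?_
  · have := congrArg (eval 1) hprod
    rw [eval_mul, h] at this
    simp [eval_finsetSum] at this
    omega
  · rw [hprod, hφ, hJ]
    simpa [jordanTotient] using HasJetAtOne.geom_sum n

theorem cyclotomic_third_deriv_one (n : ℕ) (hn : 2 ≤ n) :
    8 * (Polynomial.derivative^[3] (Polynomial.cyclotomic n ℤ)).eval 1 =
      (Polynomial.cyclotomic n ℤ).eval 1 * ((Nat.totient n : ℤ) - 2) *
        (jordanTotient 2 n + (Nat.totient n : ℤ) * ((Nat.totient n : ℤ) - 4)) := by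
  rw [mul_assoc]
  exact (hasJetAtOne_cyclotomic hn).2.2
end

section
/- For every integer n ≥ 2, one has the integer identity 240·Φ_n^{(4)}(1) = Φ_n(1)·( 30·J_2(n)·φ(n)² − 180·J_2(n)·φ(n) + 5·J_2(n)² + 220·J_2(n) − 2·J_4(n) + 15·φ(n)⁴ − 180·φ(n)³ + 660·φ(n)² − 720·φ(n) ). -/
open Polynomial Finset

/-- The Euler operator `x · d/dx` on rational polynomials. -/
noncomputable def eulerOp (p : ℚ[X]) : ℚ[X] := X * derivative p

lemma eulerOp_mul (p q : ℚ[X]) : eulerOp (p * q) = eulerOp p * q + p * eulerOp q := by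
  simp only [eulerOp, derivative_mul]; ring

lemma eulerOp_add (p q : ℚ[X]) : eulerOp (p + q) = eulerOp p + eulerOp q := by
  simp only [eulerOp, derivative_add]; ring

lemma eulerOp_iterate_geom_sum (k n : ℕ) :
    eulerOp^[k] (∑ i ∈ range n, X ^ i) = ∑ i ∈ range n, C ((i : ℚ) ^ k) * X ^ i := by
  induction k with
  | zero => simp
  | succ k ih =>
    rw [Function.iterate_succ_apply', ih, eulerOp, derivative_sum, mul_sum]
    refine sum_congr rfl fun i _ => ?_
    rcases i with _ | i
    · simp
    · rw [derivative_C_mul, derivative_X_pow, Nat.add_sub_cancel, pow_succ ((i + 1 : ℕ) : ℚ) k,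
        C_mul, pow_succ X i]
      ring

/-- The `k`-th moment at `1` of `p`: for `p = ∑ aᵢ Xⁱ`, this is `(∑ aᵢ iᵏ) / ∑ aᵢ`. -/
noncomputable def moment (k : ℕ) (p : ℚ[X]) : ℚ := (eulerOp^[k] p).eval 1 / p.eval 1

/-- The `k`-th cumulant of `p`, i.e. the `k`-th derivative at `t = 0` of `log p(eᵗ)`,
for `1 ≤ k ≤ 4` (and `0` for other `k`). -/
noncomputable def cumulant (k : ℕ) (p : ℚ[X]) : ℚ :=
  match k with
  | 1 => moment 1 p
  | 2 => moment 2 p - moment 1 p ^ 2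
  | 3 => moment 3 p - 3 * moment 1 p * moment 2 p + 2 * moment 1 p ^ 3
  | 4 => moment 4 p - 4 * moment 1 p * moment 3 p - 3 * moment 2 p ^ 2
      + 12 * moment 1 p ^ 2 * moment 2 p - 6 * moment 1 p ^ 4
  | _ => 0

lemma cumulant_mul (k : ℕ) {p q : ℚ[X]} (hp : p.eval 1 ≠ 0) (hq : q.eval 1 ≠ 0) :
    cumulant k (p * q) = cumulant k p + cumulant k q := by
  unfold cumulant
  split <;> simp only [moment, Function.iterate_succ_apply', Function.iterate_zero, id,
    eulerOp_mul, eulerOp_add, eval_add, eval_mul, add_zero] <;> field_simp <;> ring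

lemma cumulant_one (k : ℕ) : cumulant k 1 = 0 := by
  simpa using cumulant_mul k (p := 1) (q := 1) (by simp) (by simp)

lemma cumulant_prod {ι : Type*} (k : ℕ) (s : Finset ι) (f : ι → ℚ[X])
    (hf : ∀ i ∈ s, (f i).eval 1 ≠ 0) :
    cumulant k (∏ i ∈ s, f i) = ∑ i ∈ s, cumulant k (f i) := by
  classical
  induction s using Finset.induction_on with
  | empty => simp [cumulant_one]
  | insert a s ha ih =>
    rw [prod_insert ha, sum_insert ha, cumulant_mul k (hf a (mem_insert_self a s)),
      ih fun i hi => hf i (mem_insert_of_mem hi)]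
    rw [eval_prod]
    exact prod_ne_zero_iff.2 fun i hi => hf i (mem_insert_of_mem hi)

lemma sum_range_powers (n : ℕ) :
    ∑ i ∈ range n, (i : ℚ) = n * (n - 1) / 2 ∧
    ∑ i ∈ range n, (i : ℚ) ^ 2 = n * (n - 1) * (2 * n - 1) / 6 ∧
    ∑ i ∈ range n, (i : ℚ) ^ 3 = n ^ 2 * (n - 1) ^ 2 / 4 ∧
    ∑ i ∈ range n, (i : ℚ) ^ 4
      = n * (n - 1) * (2 * n - 1) * (3 * n ^ 2 - 3 * n - 1) / 30 := by
  induction n with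
  | zero => simp
  | succ n ih =>
    obtain ⟨h1, h2, h3, h4⟩ := ih
    refine ⟨?_, ?_, ?_, ?_⟩ <;> rw [sum_range_succ] <;> simp only [h1, h2, h3, h4] <;>
      push_cast <;> ring

/-- `cumulantCoeff k = B_k / k` with `B_k` the Bernoulli numbers (`B_1 = 1/2`), for `k ≤ 4`. -/
def cumulantCoeff : ℕ → ℚ
  | 1 => 1 / 2
  | 2 => 1 / 12
  | 4 => -1 / 120
  | _ => 0

lemma cumulant_geom_sum (k : ℕ) {n : ℕ} (hn : 0 < n) :
    cumulant k (∑ i ∈ range n, X ^ i) = cumulantCoeff k * ((n : ℚ) ^ k - 1) := by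
  have hn' : (n : ℚ) ≠ 0 := by positivity
  obtain ⟨h1, h2, h3, h4⟩ := sum_range_powers n
  have key (j : ℕ) : moment j (∑ i ∈ range n, X ^ i) = (∑ i ∈ range n, (i : ℚ) ^ j) / n := by
    simp [moment, eulerOp_iterate_geom_sum, eval_finsetSum]
  unfold cumulant
  split <;> simp only [key, pow_one, h1, h2, h3, h4, cumulantCoeff] <;> field_simp <;> ring

lemma eval_one_cyclotomic_ne_zero {n : ℕ} (hn : 0 < n) (h1 : n ≠ 1) :
    (cyclotomic n ℚ).eval 1 ≠ 0 := by
  intro h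
  have h0 := eval_eq_zero_of_dvd_of_eval_eq_zero
    (cyclotomic_dvd_geom_sum_of_dvd ℚ (dvd_refl n) h1) h
  simp [eval_finsetSum, hn.ne'] at h0

lemma sum_divisors_cumulant (k : ℕ) {n : ℕ} (hn : 0 < n) :
    ∑ d ∈ n.divisors, (if d = 1 then cumulantCoeff k else cumulant k (cyclotomic d ℚ))
      = cumulantCoeff k * (n : ℚ) ^ k := by
  rw [← add_sum_erase _ _ (Nat.one_mem_divisors.2 hn.ne'), if_pos rfl,
    sum_congr rfl fun d hd => if_neg (mem_erase.1 hd).1, ← cumulant_prod,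
    prod_cyclotomic_eq_geom_sum hn, cumulant_geom_sum k hn]
  · ring
  · intro d hd
    obtain ⟨hd1, hd⟩ := mem_erase.1 hd
    exact eval_one_cyclotomic_ne_zero (Nat.pos_of_mem_divisors hd) hd1

lemma moebius_inversion_jordanTotient (k : ℕ) (c : ℚ) (f : ℕ → ℚ)
    (hf : ∀ n : ℕ, 0 < n → ∑ d ∈ n.divisors, f d = c * (n : ℚ) ^ k) {n : ℕ} (hn : 0 < n) :
    f n = c * jordanTotient k n := by
  rw [← ArithmeticFunction.sum_eq_iff_sum_mul_moebius_eq.1 hf n hn,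
    Nat.sum_divisorsAntidiagonal'
      (fun a b => ((ArithmeticFunction.moebius a : ℤ) : ℚ) * (c * (b : ℚ) ^ k)),
    jordanTotient]
  push_cast
  rw [mul_sum]
  exact sum_congr rfl fun d _ => by ring

lemma jordanTotient_one {n : ℕ} (hn : 0 < n) : jordanTotient 1 n = (n.totient : ℤ) := by
  have h := moebius_inversion_jordanTotient 1 1 (fun n => (n.totient : ℚ))
    (fun m _ => by rw [← Nat.cast_sum, Nat.sum_totient]; simp) hn
  rw [one_mul] at h
  exact_mod_cast h.symm

lemma cumulant_cyclotomic (k : ℕ) {n : ℕ} (hn : 2 ≤ n) :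
    cumulant k (cyclotomic n ℚ) = cumulantCoeff k * jordanTotient k n := by
  have h := moebius_inversion_jordanTotient k (cumulantCoeff k) _
    (fun m hm => sum_divisors_cumulant k hm) (show 0 < n by omega)
  rwa [if_neg (by omega)] at h

lemma eval_one_iterate_derivative_four (p : ℚ[X]) :
    (derivative^[4] p).eval 1 = (eulerOp^[4] p).eval 1 - 6 * (eulerOp^[3] p).eval 1
      + 11 * (eulerOp^[2] p).eval 1 - 6 * (eulerOp^[1] p).eval 1 := by
  simp only [Function.iterate_succ_apply', Function.iterate_zero, id, eulerOp, derivative_mul,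
    derivative_add, derivative_X, eval_add, eval_mul, eval_X, one_mul]
  ring

theorem cyclotomic_fourth_deriv_one (n : ℕ) (hn : 2 ≤ n) :
    240 * (Polynomial.derivative^[4] (Polynomial.cyclotomic n ℤ)).eval 1 =
      (Polynomial.cyclotomic n ℤ).eval 1 *
        (30 * jordanTotient 2 n * (Nat.totient n : ℤ) ^ 2
          - 180 * jordanTotient 2 n * (Nat.totient n : ℤ)
          + 5 * jordanTotient 2 n ^ 2 + 220 * jordanTotient 2 n - 2 * jordanTotient 4 n
          + 15 * (Nat.totient n : ℤ) ^ 4 - 180 * (Nat.totient n : ℤ) ^ 3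
          + 660 * (Nat.totient n : ℤ) ^ 2 - 720 * (Nat.totient n : ℤ)) := by
  have hP : (cyclotomic n ℚ).eval 1 ≠ 0 := eval_one_cyclotomic_ne_zero (by omega) (by omega)
  have h1 := cumulant_cyclotomic 1 hn
  have h2 := cumulant_cyclotomic 2 hn
  have h3 := cumulant_cyclotomic 3 hn
  have h4 := cumulant_cyclotomic 4 hn
  rw [jordanTotient_one (by omega)] at h1
  simp only [cumulant, cumulantCoeff, Int.cast_natCast, zero_mul] at h1 h2 h3 h4
  have hm2 := eq_add_of_sub_eq h2
  have hm3 : moment 3 (cyclotomic n ℚ) = 3 * moment 1 (cyclotomic n ℚ) *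
      moment 2 (cyclotomic n ℚ) - 2 * moment 1 (cyclotomic n ℚ) ^ 3 := by linear_combination h3
  have hm4 : moment 4 (cyclotomic n ℚ) = -1 / 120 * (jordanTotient 4 n : ℚ)
      + 4 * moment 1 (cyclotomic n ℚ) * moment 3 (cyclotomic n ℚ)
      + 3 * moment 2 (cyclotomic n ℚ) ^ 2
      - 12 * moment 1 (cyclotomic n ℚ) ^ 2 * moment 2 (cyclotomic n ℚ)
      + 6 * moment 1 (cyclotomic n ℚ) ^ 4 := by linear_combination h4
  have hm (k : ℕ) : (eulerOp^[k] (cyclotomic n ℚ)).eval 1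
      = (cyclotomic n ℚ).eval 1 * moment k (cyclotomic n ℚ) := by
    rw [moment, mul_div_cancel₀ _ hP]
  have hcast : (((cyclotomic n ℤ).eval 1 : ℤ) : ℚ) = (cyclotomic n ℚ).eval 1 := by
    rw [← map_cyclotomic_int n ℚ, eval_one_map, eq_intCast]
  have hcast4 : (((derivative^[4] (cyclotomic n ℤ)).eval 1 : ℤ) : ℚ)
      = (derivative^[4] (cyclotomic n ℚ)).eval 1 := by
    rw [← map_cyclotomic_int n ℚ, iterate_derivative_map, eval_one_map, eq_intCast]
  rw [← Int.cast_inj (α := ℚ)]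
  push_cast
  rw [hcast, hcast4, eval_one_iterate_derivative_four]
  simp only [hm]
  rw [hm4, hm3, hm2, h1]
  ring
end

section
/- Let k ≥ 1 be an integer, p a prime, and e ≥ 1 an integer such that λ(p^e) does not divide k. Then for every positive integer n₀ there exists a prime q ≥ n₀ such that p^e does not divide J_k(q) = q^k − 1. Consequently, for any integer M divisible by such a prime power p^e and any n₀, there exists n ≥ n₀ with J_k(n) ≢ 0 (mod M). -/
open Polynomial Finset

/-- Carmichael lambda function: the exponent of the unit group of `ℤ/mℤ`. -/
noncomputable def carmichael (m : ℕ) : ℕ := Monoid.exponent (ZMod m)ˣ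

theorem jordanTotient_prime (k : ℕ) {q : ℕ} (hq : q.Prime) :
    jordanTotient k q = (q : ℤ) ^ k - 1 := by
  rw [jordanTotient, hq.sum_divisors, Nat.div_self hq.pos, Nat.div_one,
    ArithmeticFunction.moebius_apply_one, ArithmeticFunction.moebius_apply_prime hq]
  push_cast
  ring

theorem exists_prime_ge_not_dvd_pow_sub_one {k m : ℕ} [NeZero m] (h : ¬ carmichael m ∣ k)
    (n₀ : ℕ) : ∃ q : ℕ, q.Prime ∧ n₀ ≤ q ∧ ¬ ((m : ℤ) ∣ (q : ℤ) ^ k - 1) := by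
  rw [carmichael, Monoid.exponent_dvd_iff_forall_pow_eq_one] at h
  push Not at h
  obtain ⟨u, hu⟩ := h
  obtain ⟨q, hlt, hq, hqu⟩ := Nat.forall_exists_prime_gt_and_eq_mod u.isUnit n₀
  refine ⟨q, hq, hlt.le, fun hdvd => hu (Units.ext ?_)⟩
  rw [← ZMod.intCast_zmod_eq_zero_iff_dvd] at hdvd
  push_cast at hdvd ⊢
  rwa [hqu, sub_eq_zero] at hdvd

theorem jordanTotient_not_congruent (k : ℕ) (hk : 1 ≤ k) (p : ℕ) (hp : p.Prime)
    (e : ℕ) (he : 1 ≤ e) (hndvd : ¬ carmichael (p ^ e) ∣ k) :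
    (∀ n₀ : ℕ, 0 < n₀ → ∃ q : ℕ, q.Prime ∧ n₀ ≤ q ∧
        ¬ ((p : ℤ) ^ e ∣ (q : ℤ) ^ k - 1)) ∧
      ∀ M : ℤ, ((p : ℤ) ^ e ∣ M) → ∀ n₀ : ℕ, 0 < n₀ →
        ∃ n : ℕ, n₀ ≤ n ∧ ¬ (M ∣ jordanTotient k n) := by
  have : NeZero (p ^ e) := ⟨pow_ne_zero e hp.ne_zero⟩
  have key := exists_prime_ge_not_dvd_pow_sub_one hndvd
  push_cast at key
  refine ⟨fun n₀ _ => key n₀, fun M hM n₀ _ => ?_⟩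
  obtain ⟨q, hq, hle, hdvd⟩ := key n₀
  refine ⟨q, hle, fun h => hdvd ?_⟩
  rw [← jordanTotient_prime k hq]
  exact hM.trans h
end

section
/- Let q ≥ 1 be an integer and t_1, …, t_q be complex numbers. Define b(h) for 0 ≤ h ≤ 2q by ∏_{j=1}^{q}(x² + t_j·x + t_j) = Σ_{h=0}^{2q} b(h)·x^h, and a(ℓ) for 0 ≤ ℓ ≤ q by ∏_{j=1}^{q}(y + t_j) = Σ_{ℓ=0}^{q} a(ℓ)·y^ℓ. Then for every h with 0 ≤ h ≤ 2q, b(h) = Σ_{ℓ=0}^{⌊h/2⌋} C(q−ℓ, h−2ℓ)·a(ℓ), where C(m, r) denotes the binomial coefficient (with the convention C(m, r) = 0 when r > m). -/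
open Polynomial Finset

/-- Homogenized form of the expansion of `∏ i ∈ s, (X + C (f i))` in powers of `X`. -/
theorem prod_add_algebraMap_mul_eq_sum_coeff {ι R A : Type*} [CommSemiring R] [CommSemiring A]
    [Algebra R A] (s : Finset ι) (f : ι → R) (u v : A) :
    ∏ i ∈ s, (u + algebraMap R A (f i) * v) =
      ∑ k ∈ Finset.range (#s + 1),
        algebraMap R A ((∏ i ∈ s, (X + C (f i))).coeff k) * (u ^ k * v ^ (#s - k)) := by
  classical
  simp_rw [add_comm u]
  rw [Finset.prod_add, Finset.sum_powerset, ← Finset.sum_range_reflect]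
  refine Finset.sum_congr rfl fun k hk => ?_
  have hks : k ≤ #s := Nat.lt_succ_iff.mp (Finset.mem_range.mp hk)
  rw [Finset.prod_X_add_C_coeff s f hks, map_sum, Finset.sum_mul,
    show #s + 1 - 1 - k = #s - k by omega]
  refine Finset.sum_congr rfl fun w hw => ?_
  obtain ⟨hws, hwc⟩ := Finset.mem_powersetCard.mp hw
  rw [Finset.prod_mul_distrib, Finset.prod_const, Finset.prod_const,
    Finset.card_sdiff_of_subset hws, hwc, map_prod, Nat.sub_sub_self hks]
  ring

theorem coeff_prod_quadratic_eq_sum_choose (q : ℕ) (hq : 1 ≤ q) (t : ℕ → ℂ)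
    (h : ℕ) (hh : h ≤ 2 * q) :
    (∏ j ∈ Finset.range q, (X ^ 2 + C (t j) * X + C (t j))).coeff h =
      ∑ ℓ ∈ Finset.range (h / 2 + 1),
        ((q - ℓ).choose (h - 2 * ℓ) : ℂ) *
          (∏ j ∈ Finset.range q, (X + C (t j))).coeff ℓ := by
  have key : ∏ j ∈ Finset.range q, (X ^ 2 + C (t j) * X + C (t j)) =
      ∏ j ∈ Finset.range q, (X ^ 2 + algebraMap ℂ ℂ[X] (t j) * (X + 1)) :=
    Finset.prod_congr rfl fun j _ => by rw [Polynomial.algebraMap_eq]; ring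
  rw [key, prod_add_algebraMap_mul_eq_sum_coeff, Finset.card_range, Polynomial.finsetSum_coeff]
  symm
  apply Finset.sum_subset_zero_on_sdiff
  · exact Finset.range_subset_range.mpr (by omega)
  · intro ℓ hℓ
    have hlt : h < 2 * ℓ := by
      simp only [Finset.mem_sdiff, Finset.mem_range] at hℓ
      omega
    rw [Polynomial.algebraMap_eq, coeff_C_mul, ← pow_mul, coeff_X_pow_mul', if_neg (by omega),
      mul_zero]
  · intro ℓ hℓ
    have hle : 2 * ℓ ≤ h := by
      have := Finset.mem_range.mp hℓ
      omega
    rw [Polynomial.algebraMap_eq, coeff_C_mul, ← pow_mul, coeff_X_pow_mul', if_pos hle,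
      coeff_X_add_one_pow, mul_comm]
end

section
/- Let q ≥ 1 be an integer and let f ∈ ℤ[x] be a self-reciprocal polynomial of degree 2q (f.coeff(i) = f.coeff(2q − i) for all i). Then 2q − 2 divides 2·f'''(1) in ℤ. Moreover, if q is even, then 2q − 2 divides f'''(1). -/
open Polynomial

theorem Nat.cast_descFactorial_three (i : ℕ) :
    ((i.descFactorial 3 : ℕ) : ℤ) = i * (i - 1) * (i - 2) := by
  rcases i with _ | _ | i
  · simp
  · simp
  · simp [Nat.descFactorial_succ]
    ring

theorem Polynomial.eval_one_iterate_derivative_three (f : ℤ[X]) :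
    (derivative^[3] f).eval 1 =
      ∑ i ∈ Finset.range (f.natDegree + 1), f.coeff i * ((i : ℤ) * (i - 1) * (i - 2)) := by
  conv_lhs => rw [f.as_sum_range_C_mul_X_pow]
  rw [iterate_derivative_sum, eval_finsetSum]
  refine Finset.sum_congr rfl fun i _ => ?_
  rw [iterate_derivative_C_mul, iterate_derivative_X_pow_eq_natCast_mul,
    ← Nat.cast_descFactorial_three]
  simp

theorem Finset.sum_range_two_mul_add_one_eq_sum_add_reflect {M : Type*} [AddCommMonoid M]
    (h : ℕ → M) (q : ℕ) :
    ∑ i ∈ Finset.range (2 * q + 1), h i =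
      ∑ i ∈ Finset.range q, (h i + h (2 * q - i)) + h q := by
  rw [show 2 * q + 1 = q + 1 + q by ring, Finset.sum_range_add, Finset.sum_range_succ,
    Finset.sum_add_distrib, ← Finset.sum_range_reflect (fun x => h (q + 1 + x))]
  have key : ∑ j ∈ Finset.range q, h (q + 1 + (q - 1 - j)) =
      ∑ j ∈ Finset.range q, h (2 * q - j) :=
    Finset.sum_congr rfl fun j hj => by
      rw [Finset.mem_range] at hj
      congr 1
      omega
  rw [key, add_right_comm]

theorem selfReciprocal_third_deriv_dvd (q : ℕ) (hq : 1 ≤ q) (f : Polynomial ℤ)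
    (hdeg : f.natDegree = 2 * q)
    (hsym : ∀ i ≤ 2 * q, f.coeff i = f.coeff (2 * q - i)) :
    (2 * (q : ℤ) - 2) ∣ 2 * (Polynomial.derivative^[3] f).eval 1 ∧
      (Even q → (2 * (q : ℤ) - 2) ∣ (Polynomial.derivative^[3] f).eval 1) := by
  rw [eval_one_iterate_derivative_three, hdeg,
    Finset.sum_range_two_mul_add_one_eq_sum_add_reflect]
  have pairs : (2 * (q : ℤ) - 2) ∣ ∑ i ∈ Finset.range q,
      (f.coeff i * ((i : ℤ) * (i - 1) * (i - 2)) + f.coeff (2 * q - i) *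
        (((2 * q - i : ℕ) : ℤ) * ((2 * q - i : ℕ) - 1) * ((2 * q - i : ℕ) - 2))) := by
    refine Finset.dvd_sum fun i hi => ?_
    have hi' : i ≤ 2 * q := by
      rw [Finset.mem_range] at hi
      omega
    rw [← hsym i hi']
    push_cast [hi']
    exact ⟨f.coeff i * (2 * q * (2 * q - 1) - 3 * (i * (2 * q - i))), by ring⟩
  constructor
  · rw [mul_add]
    exact dvd_add (pairs.mul_left 2) ⟨f.coeff q * (q * (q - 2)), by ring⟩
  · rintro ⟨k, rfl⟩
    refine dvd_add pairs ⟨f.coeff (k + k) * (k * (2 * k - 2)), ?_⟩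
    push_cast
    ring
end

section
/- Let q ≥ 1 and k ≥ 2 be integers and let f ∈ ℤ[x] be a self-reciprocal polynomial of degree 2q (f.coeff(i) = f.coeff(2q − i) for all i). Then 2q − 2k divides f^{(2k+1)}(1) in ℤ, where f^{(2k+1)} is the (2k+1)-st formal derivative of f. -/
open Polynomial

theorem descPochhammer_eval_reflect (k : ℕ) (y : ℤ) :
    (descPochhammer ℤ (2 * k + 1)).eval (2 * (k : ℤ) - y) =
      -(descPochhammer ℤ (2 * k + 1)).eval y := by
  rw [descPochhammer_eval_eq_prod_range, descPochhammer_eval_eq_prod_range,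
    ← Finset.prod_range_reflect]
  have h : ∀ j ∈ Finset.range (2 * k + 1),
      2 * (k : ℤ) - y - ((2 * k + 1 - 1 - j : ℕ) : ℤ) = -1 * (y - j) := by
    intro j hj
    rw [Finset.mem_range] at hj
    rw [Nat.add_sub_cancel, Nat.cast_sub (by omega)]
    push_cast
    ring
  rw [Finset.prod_congr rfl h, Finset.prod_mul_distrib]
  simp [pow_add, pow_mul]

theorem dvd_descPochhammer_eval_add_reflect (q k : ℕ) (y : ℤ) :
    2 * (q : ℤ) - 2 * k ∣ (descPochhammer ℤ (2 * k + 1)).eval y +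
      (descPochhammer ℤ (2 * k + 1)).eval (2 * (q : ℤ) - y) := by
  have h := sub_dvd_eval_sub (2 * (q : ℤ) - y) (2 * (k : ℤ) - y) (descPochhammer ℤ (2 * k + 1))
  rwa [descPochhammer_eval_reflect, sub_sub_sub_cancel_right, sub_neg_eq_add, add_comm] at h

theorem dvd_descPochhammer_eval_self (q k : ℕ) (hk : 2 ≤ k) :
    2 * (q : ℤ) - 2 * k ∣ (descPochhammer ℤ (2 * k + 1)).eval (q : ℤ) := by
  rw [descPochhammer_eval_eq_prod_range,
    ← Finset.mul_prod_erase _ _ (Finset.mem_range.2 (by omega : k < 2 * k + 1)),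
    ← mul_sub, mul_comm (2 : ℤ)]
  refine mul_dvd_mul_left _ ?_
  obtain h | h := Int.even_or_odd (q : ℤ)
  · exact (by simpa using h.two_dvd : (2 : ℤ) ∣ (q : ℤ) - (0 : ℕ)).trans
      (Finset.dvd_prod_of_mem (fun j : ℕ => (q : ℤ) - j)
        (Finset.mem_erase.2 ⟨by omega, Finset.mem_range.2 (by omega)⟩))
  · exact (by simpa using (h.sub_odd odd_one).two_dvd : (2 : ℤ) ∣ (q : ℤ) - (1 : ℕ)).trans
      (Finset.dvd_prod_of_mem (fun j : ℕ => (q : ℤ) - j)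
        (Finset.mem_erase.2 ⟨by omega, Finset.mem_range.2 (by omega)⟩))

theorem eval_one_iterate_derivative_eq_sum (f : ℤ[X]) (n N : ℕ) (hN : f.natDegree < N) :
    (derivative^[n] f).eval 1 =
      ∑ i ∈ Finset.range N, f.coeff i * (descPochhammer ℤ n).eval (i : ℤ) := by
  conv_lhs => rw [f.as_sum_range_C_mul_X_pow' hN]
  rw [iterate_derivative_sum, eval_finsetSum]
  refine Finset.sum_congr rfl fun i _ => ?_
  rw [iterate_derivative_C_mul, iterate_derivative_X_pow_eq_natCast_mul,
    descPochhammer_eval_eq_descFactorial]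
  simp

theorem dvd_sum_range_of_symm (q : ℕ) (m : ℤ) (a P : ℕ → ℤ)
    (ha : ∀ i ≤ 2 * q, a i = a (2 * q - i)) (hP : ∀ i ≤ 2 * q, m ∣ P i + P (2 * q - i))
    (hmid : m ∣ P q) : m ∣ ∑ i ∈ Finset.range (2 * q + 1), a i * P i := by
  rw [show 2 * q + 1 = q + 1 + q by ring, Finset.sum_range_add, Finset.sum_range_succ,
    ← Finset.sum_range_reflect (fun i => a (q + 1 + i) * P (q + 1 + i)), add_right_comm,
    ← Finset.sum_add_distrib]
  refine dvd_add (Finset.dvd_sum fun i hi => ?_) (hmid.mul_left _)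
  rw [Finset.mem_range] at hi
  rw [show q + 1 + (q - 1 - i) = 2 * q - i by omega, ← ha i (by omega), ← mul_add]
  exact (hP i (by omega)).mul_left _

theorem selfReciprocal_odd_deriv_dvd (q k : ℕ) (hq : 1 ≤ q) (hk : 2 ≤ k)
    (f : Polynomial ℤ) (hdeg : f.natDegree = 2 * q)
    (hsym : ∀ i ≤ 2 * q, f.coeff i = f.coeff (2 * q - i)) :
    (2 * (q : ℤ) - 2 * (k : ℤ)) ∣ (Polynomial.derivative^[2 * k + 1] f).eval 1 := by
  rw [eval_one_iterate_derivative_eq_sum f _ (2 * q + 1) (by omega)]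
  refine dvd_sum_range_of_symm q _ f.coeff
    (fun i => (descPochhammer ℤ (2 * k + 1)).eval (i : ℤ)) hsym (fun i hi => ?_)
    (dvd_descPochhammer_eval_self q k hk)
  simpa [Nat.cast_sub hi] using dvd_descPochhammer_eval_add_reflect q k i
end
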